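/- arXiv:2408.09147 — 4 statements merged into one kernel-verified Lean document; each statement's English description precedes it below -/
import Mathlib

section
/- (Proposition 1) Let m > 0 be real, R a real 3×3 orthogonal matrix, r ∈ ℝ³, and I_B a real 3×3 symmetric positive-definite matrix. Then the 6×6 block matrix M_A = [[m·I₃, −m·(r×)],[m·(r×), I_A]] with I_A = R·I_B·Rᵀ − m·(r×)² is symmetric and positive definite. -/
open Matrix

/-- Cross-product (skew-symmetric) matrix of a vector `r ∈ ℝ³`. -/
def skewMat (r : Fin 3 → ℝ) : Matrix (Fin 3) (Fin 3) ℝ :=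
  !![0, -r 2, r 1; r 2, 0, -r 0; -r 1, r 0, 0]

theorem skewMat_transpose (r : Fin 3 → ℝ) : (skewMat r)ᵀ = -skewMat r := by
  ext i j
  fin_cases i <;> fin_cases j <;> simp [skewMat]

theorem posDef_blockDiag (A D : Matrix (Fin 3) (Fin 3) ℝ) (hA : A.PosDef) (hD : D.PosDef) :
    (fromBlocks A 0 0 D).PosDef := by
  rw [posDef_iff_dotProduct_mulVec]
  refine ⟨IsHermitian.fromBlocks hA.1 (by simp) hD.1, fun x hx => ?_⟩
  obtain ⟨u, v, rfl⟩ : ∃ u v, x = Sum.elim u v :=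
    ⟨x ∘ Sum.inl, x ∘ Sum.inr, (Sum.elim_comp_inl_inr x).symm⟩
  have hA0 := hA.posSemidef.dotProduct_mulVec_nonneg u
  have hD0 := hD.posSemidef.dotProduct_mulVec_nonneg v
  have key : star (Sum.elim u v) ⬝ᵥ (fromBlocks A 0 0 D *ᵥ Sum.elim u v)
      = star u ⬝ᵥ (A *ᵥ u) + star v ⬝ᵥ (D *ᵥ v) := by
    simp [fromBlocks_mulVec, dotProduct, Fintype.sum_sum_type]
  rw [key]
  by_cases hu : u = 0
  · have hv : v ≠ 0 := by
      rintro rfl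
      apply hx
      subst hu
      ext i
      cases i <;> rfl
    have := hD.dotProduct_mulVec_pos hv
    linarith
  · have := hA.dotProduct_mulVec_pos hu
    linarith

/-- Proposition 1: the spatial inertia matrix
`M_A = [[m·I₃, −m·(r×)],[m·(r×), I_A]]`, `I_A = R·I_B·Rᵀ − m·(r×)²`,
is symmetric and positive definite whenever `m > 0`, `R` is orthogonal and
`I_B` is symmetric positive definite. -/
theorem spatial_inertia_symm_posDef (m : ℝ) (hm : 0 < m)
    (R : Matrix (Fin 3) (Fin 3) ℝ) (hR : R * Rᵀ = 1) (r : Fin 3 → ℝ)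
    (I_B : Matrix (Fin 3) (Fin 3) ℝ) (hIB : I_B.PosDef) (hIBsymm : I_B.IsSymm) :
    (fromBlocks (m • (1 : Matrix (Fin 3) (Fin 3) ℝ)) (-(m • skewMat r))
      (m • skewMat r) (R * I_B * Rᵀ - m • (skewMat r ^ 2))).IsSymm ∧
    (fromBlocks (m • (1 : Matrix (Fin 3) (Fin 3) ℝ)) (-(m • skewMat r))
      (m • skewMat r) (R * I_B * Rᵀ - m • (skewMat r ^ 2))).PosDef := by
  have hpd : (fromBlocks (m • (1 : Matrix (Fin 3) (Fin 3) ℝ)) (-(m • skewMat r))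
      (m • skewMat r) (R * I_B * Rᵀ - m • (skewMat r ^ 2))).PosDef := by
    have hRu : IsUnit R := IsUnit.of_mul_eq_one _ hR
    have hU : IsUnit (fromBlocks R 0 (skewMat r * R) R) :=
      isUnit_fromBlocks_zero₁₂.2 ⟨hRu, hRu⟩
    have hD := posDef_blockDiag (m • 1) I_B (PosDef.one.smul hm) hIB
    have h := (IsUnit.posDef_star_right_conjugate_iff hU).2 hD
    convert h using 1
    rw [star_eq_conjTranspose, conjTranspose_eq_transpose_of_trivial, fromBlocks_transpose,
      fromBlocks_multiply, fromBlocks_multiply]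
    have h1 : skewMat r * R * (Rᵀ * skewMat r) = skewMat r * skewMat r := by
      rw [Matrix.mul_assoc, ← Matrix.mul_assoc R, hR, Matrix.one_mul]
    have h2 : R * (Rᵀ * skewMat r) = skewMat r := by
      rw [← Matrix.mul_assoc, hR, Matrix.one_mul]
    have h3 : skewMat r * R * Rᵀ = skewMat r := by
      rw [Matrix.mul_assoc, hR, Matrix.mul_one]
    simp [transpose_mul, skewMat_transpose, hR, h1, h2, h3, pow_two]
    abel
  refine ⟨?_, hpd⟩
  have := hpd.1
  rwa [IsHermitian, conjTranspose_eq_transpose_of_trivial] at this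
end

section
/- (Residual dynamics of the generalized momentum observer) Let K be a real 6×6 matrix, let H : ℝ → ℝ⁶ be differentiable, let 𝔉 : ℝ → ℝ⁶ be continuous, and define F_d(t) = Ḣ(t) − 𝔉(t). Suppose R : ℝ → ℝ⁶ is continuous and satisfies the integral equation R(t) = K·( H(t) − H(t₀) − ∫_{t₀}^{t} (𝔉(s) + R(s)) ds ) for all t ≥ t₀. Then R(t₀) = 0, R is differentiable, and Ṙ(t) = −K·R(t) + K·F_d(t) for all t ≥ t₀. -/
open Matrix intervalIntegral

/-- Residual dynamics of the generalized momentum observer: if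
`R(t) = K·(H(t) − H(t₀) − ∫_{t₀}^t (𝔉 + R))` for all `t ≥ t₀`, then `R(t₀) = 0`
and `Ṙ = −K·R + K·F_d` with `F_d = Ḣ − 𝔉` on `[t₀, ∞)`. -/
theorem gmo_residual_dynamics (K : Matrix (Fin 6) (Fin 6) ℝ)
    (H : ℝ → (Fin 6 → ℝ)) (hH : Differentiable ℝ H)
    (𝔉 : ℝ → (Fin 6 → ℝ)) (h𝔉 : Continuous 𝔉)
    (t₀ : ℝ) (R : ℝ → (Fin 6 → ℝ)) (hRcont : Continuous R)
    (hR : ∀ t, t₀ ≤ t →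
      R t = K *ᵥ (H t - H t₀ - ∫ s in t₀..t, (𝔉 s + R s))) :
    R t₀ = 0 ∧ ∀ t, t₀ ≤ t →
      HasDerivWithinAt R (-(K *ᵥ R t) + K *ᵥ (deriv H t - 𝔉 t))
        (Set.Ici t₀) t := by
  refine ⟨by rw [hR t₀ le_rfl]; simp, fun t ht => ?_⟩
  have hc : Continuous (fun s => 𝔉 s + R s) := h𝔉.add hRcont
  have h1 : HasDerivAt (fun u => ∫ s in t₀..u, (𝔉 s + R s)) (𝔉 t + R t) t :=
    hc.integral_hasStrictDerivAt t₀ t |>.hasDerivAt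
  have h2 : HasDerivAt (fun u => H u - H t₀ - ∫ s in t₀..u, (𝔉 s + R s))
      (deriv H t - (𝔉 t + R t)) t :=
    ((hH t).hasDerivAt.sub_const (H t₀)).sub h1
  have h3 := (LinearMap.toContinuousLinearMap (Matrix.mulVecLin K)).hasFDerivAt.comp_hasDerivAt t h2
  have h4 : HasDerivAt (fun u => K *ᵥ (H u - H t₀ - ∫ s in t₀..u, (𝔉 s + R s)))
      (K *ᵥ (deriv H t - (𝔉 t + R t))) t := h3
  have h5 : -(K *ᵥ R t) + K *ᵥ (deriv H t - 𝔉 t) = K *ᵥ (deriv H t - (𝔉 t + R t)) := by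
    simp only [Matrix.mulVec_sub, Matrix.mulVec_add]
    abel
  rw [h5]
  exact h4.hasDerivWithinAt.congr (fun u hu => hR u hu) (hR t ht)
end

section
/- (High-gain residual accuracy) Let k > 0, let f : [0,∞) → ℝ be continuously differentiable with |f′(t)| ≤ L for all t ≥ 0, and let r : [0,∞) → ℝ satisfy ṙ(t) = −k·r(t) + k·f(t) with r(0) = 0. Then for all t ≥ 0, |r(t) − f(t)| ≤ |f(0)|·e^{−k·t} + L/k. In particular, the residual tracks the disturbance with steady-state error at most L/k, which tends to 0 as k → ∞. -/
open Set

/-- High-gain residual accuracy: if `ṙ = −k·r + k·f` with `r(0) = 0`, `k > 0`,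
and `f` is continuously differentiable with `|f′| ≤ L` on `[0,∞)`, then
`|r(t) − f(t)| ≤ |f(0)|·e^{−k·t} + L/k` for all `t ≥ 0`. -/
theorem high_gain_residual_accuracy (k L : ℝ) (hk : 0 < k)
    (f f' r : ℝ → ℝ)
    (hf : ∀ t ∈ Set.Ici (0 : ℝ), HasDerivWithinAt f (f' t) (Set.Ici 0) t)
    (hf'cont : ContinuousOn f' (Set.Ici 0))
    (hf'bdd : ∀ t ∈ Set.Ici (0 : ℝ), |f' t| ≤ L)
    (hr : ∀ t ∈ Set.Ici (0 : ℝ),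
      HasDerivWithinAt r (-k * r t + k * f t) (Set.Ici 0) t)
    (hr0 : r 0 = 0) :
    ∀ t ∈ Set.Ici (0 : ℝ),
      |r t - f t| ≤ |f 0| * Real.exp (-k * t) + L / k := by
  intro T hT
  have hT0 : (0 : ℝ) ≤ T := hT
  have hL : 0 ≤ L := (abs_nonneg _).trans (hf'bdd 0 (by simp))
  have hexp : ∀ t : ℝ, HasDerivAt (fun s => Real.exp (k * s)) (Real.exp (k * t) * k) t := by
    intro t
    simpa using ((hasDerivAt_id t).const_mul k).exp
  have hg : ∀ t ∈ Set.Ici (0 : ℝ), HasDerivWithinAt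
      (fun s => Real.exp (k * s) * (r s - f s)) (-(Real.exp (k * t) * f' t)) (Set.Ici 0) t := by
    intro t ht
    have h := (hexp t).hasDerivWithinAt.mul ((hr t ht).sub (hf t ht))
    refine h.congr_deriv ?_
    simp only [Pi.sub_apply]
    ring
  have hB : ∀ t : ℝ, HasDerivAt (fun s => |f 0| + L / k * (Real.exp (k * s) - 1))
      (L * Real.exp (k * t)) t := by
    intro t
    refine ((((hexp t).sub_const 1).const_mul (L / k)).const_add |f 0|).congr_deriv ?_
    field_simp
  have key := image_norm_le_of_norm_deriv_right_le_deriv_boundary (a := 0) (b := T)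
    (f := fun s => Real.exp (k * s) * (r s - f s))
    (f' := fun t => -(Real.exp (k * t) * f' t))
    (fun t ht => ((hg t ht.1).continuousWithinAt).mono Set.Icc_subset_Ici_self)
    (fun t ht => (hg t ht.1).mono (Set.Ici_subset_Ici.2 ht.1))
    (B := fun s => |f 0| + L / k * (Real.exp (k * s) - 1))
    (B' := fun t => L * Real.exp (k * t))
    (by simp [hr0]) hB
    (fun t ht => by
      rw [norm_neg, norm_mul, Real.norm_eq_abs, Real.norm_eq_abs, Real.abs_exp, mul_comm]
      exact mul_le_mul_of_nonneg_right (hf'bdd t ht.1) (Real.exp_pos _).le)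
    (Set.right_mem_Icc.2 hT0)
  simp only [norm_mul, Real.norm_eq_abs, Real.abs_exp] at key
  have he : Real.exp (-k * T) * Real.exp (k * T) = 1 := by
    rw [← Real.exp_add]; simp
  have hp := Real.exp_pos (k * T)
  have hLk : 0 ≤ L / k := div_nonneg hL hk.le
  refine le_of_mul_le_mul_left (key.trans ?_) hp
  have : Real.exp (k * T) * (|f 0| * Real.exp (-k * T) + L / k)
      = |f 0| * (Real.exp (-k * T) * Real.exp (k * T)) + L / k * Real.exp (k * T) := by ring
  rw [this, he]
  linarith
end

section
/- (Pseudo-inertia map is a linear bijection) The map f sending a triple (m, h, I) with m ∈ ℝ, h ∈ ℝ³, and I a real symmetric 3×3 matrix, to the real symmetric 4×4 matrix L = [[½·tr(I)·I₃ − I, h],[hᵀ, m]], is a linear bijection from ℝ × ℝ³ × Sym(3) onto Sym(4); its inverse sends L = [[Σ, h],[hᵀ, m]] (with Σ ∈ Sym(3)) to (m, h, tr(Σ)·I₃ − Σ). -/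
open Matrix

/-- The pseudo-inertia map `f(m, h, I) = [[½·tr(I)·I₃ − I, h],[hᵀ, m]]`. -/
noncomputable def pseudoInertia (x : ℝ × (Fin 3 → ℝ) × Matrix (Fin 3) (Fin 3) ℝ) :
    Matrix (Fin 3 ⊕ Unit) (Fin 3 ⊕ Unit) ℝ :=
  fromBlocks ((x.2.2.trace / 2) • (1 : Matrix (Fin 3) (Fin 3) ℝ) - x.2.2)
    (Matrix.of fun i _ => x.2.1 i) (Matrix.of fun _ j => x.2.1 j)
    (Matrix.of fun _ _ => x.1)

/-- The inverse map `[[Σ, h],[hᵀ, m]] ↦ (m, h, tr(Σ)·I₃ − Σ)`. -/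
def pseudoInertiaInv (L : Matrix (Fin 3 ⊕ Unit) (Fin 3 ⊕ Unit) ℝ) :
    ℝ × (Fin 3 → ℝ) × Matrix (Fin 3) (Fin 3) ℝ :=
  (L (Sum.inr ()) (Sum.inr ()),
   fun i => L (Sum.inl i) (Sum.inr ()),
   (Matrix.of fun i j : Fin 3 => L (Sum.inl i) (Sum.inl j)).trace •
       (1 : Matrix (Fin 3) (Fin 3) ℝ) -
     Matrix.of fun i j : Fin 3 => L (Sum.inl i) (Sum.inl j))

theorem pseudoInertia_left (x : ℝ × (Fin 3 → ℝ) × Matrix (Fin 3) (Fin 3) ℝ) :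
    pseudoInertiaInv (pseudoInertia x) = x := by
  obtain ⟨m, h, J⟩ := x
  refine Prod.ext ?_ (Prod.ext ?_ ?_)
  · simp [pseudoInertia, pseudoInertiaInv]
  · ext i
    simp [pseudoInertia, pseudoInertiaInv]
  · ext i j
    fin_cases i <;> fin_cases j <;>
      simp [pseudoInertia, pseudoInertiaInv, Matrix.trace, Fin.sum_univ_three] <;> ring

theorem pseudoInertia_right (L : Matrix (Fin 3 ⊕ Unit) (Fin 3 ⊕ Unit) ℝ) (hL : L.IsSymm) :
    pseudoInertia (pseudoInertiaInv L) = L := by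
  ext (i | i) (j | j)
  · fin_cases i <;> fin_cases j <;>
      simp [pseudoInertia, pseudoInertiaInv, Matrix.trace, Fin.sum_univ_three] <;> ring
  · simp [pseudoInertia, pseudoInertiaInv]
  · simpa [pseudoInertia, pseudoInertiaInv] using hL.apply (Sum.inr ()) (Sum.inl j)
  · simp [pseudoInertia, pseudoInertiaInv]

/-- The pseudo-inertia map is a linear bijection from
`ℝ × ℝ³ × Sym(3)` onto `Sym(4)`, with inverse `pseudoInertiaInv`. -/
theorem pseudoInertia_linear_bijection :
    (∀ x y, pseudoInertia (x + y) = pseudoInertia x + pseudoInertia y) ∧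
    (∀ (c : ℝ) x, pseudoInertia (c • x) = c • pseudoInertia x) ∧
    Set.BijOn pseudoInertia
      {x : ℝ × (Fin 3 → ℝ) × Matrix (Fin 3) (Fin 3) ℝ | x.2.2.IsSymm}
      {L : Matrix (Fin 3 ⊕ Unit) (Fin 3 ⊕ Unit) ℝ | L.IsSymm} ∧
    (∀ x : ℝ × (Fin 3 → ℝ) × Matrix (Fin 3) (Fin 3) ℝ,
      x.2.2.IsSymm → pseudoInertiaInv (pseudoInertia x) = x) ∧
    (∀ L : Matrix (Fin 3 ⊕ Unit) (Fin 3 ⊕ Unit) ℝ,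
      L.IsSymm → pseudoInertia (pseudoInertiaInv L) = L) := by
  refine ⟨?_, ?_, ⟨?_, ?_, ?_⟩, fun x _ => pseudoInertia_left x, pseudoInertia_right⟩
  · intro x y
    ext (i | i) (j | j) <;> simp [pseudoInertia]
    ring
  · intro c x
    ext (i | i) (j | j) <;> simp [pseudoInertia]
    ring
  · intro x hx
    have hx' : x.2.2.IsSymm := hx
    refine Matrix.IsSymm.ext ?_
    rintro (i | i) (j | j)
    · simp [pseudoInertia, hx'.apply i j, Matrix.one_apply, eq_comm]
    all_goals simp [pseudoInertia]
  · intro x _ y _ hxy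
    rw [← pseudoInertia_left x, hxy, pseudoInertia_left]
  · intro L hL
    have hL' : L.IsSymm := hL
    refine ⟨pseudoInertiaInv L, ?_, pseudoInertia_right L hL'⟩
    refine Matrix.IsSymm.ext ?_
    intro i j
    simp [pseudoInertiaInv, hL'.apply (Sum.inl i) (Sum.inl j), Matrix.one_apply, eq_comm]
end
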